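/- Soundness of product-encoded simulations: Let ℋ and 𝒜 be finite-dimensional Hilbert spaces, H_t Hermitian on ℋ, and H_s Hermitian and positive semidefinite on ℋ⊗𝒜. Let Δ > 0 with ‖H_t‖ ≤ Δ, and let P be the spectral projector of H_s onto eigenvalues strictly below Δ. Suppose there are a unit vector |anc⟩ ∈ 𝒜 and an isometry T̃: ℋ → ℋ⊗𝒜 such that T̃T̃† = P, ‖T̃ − T‖ ≤ η ≤ 1/3 where Tψ := ψ⊗|anc⟩, and ‖P H_s P − T̃ H_t T̃†‖ ≤ ε. Then every density operator ρ on ℋ⊗𝒜 with tr(ρ H_s) ≤ ε' for some 0 ≤ ε' ≤ Δ/2 satisfies tr( tr_𝒜(ρ) · H_t ) ≤ 5ε' + ε + (4√(2η+η²) + 2η)·‖H_t‖. -/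

import Mathlib

open Matrix
open scoped Kronecker ComplexOrder

namespace QSim

/-- Index set for the computational basis of `n` qubits. -/
abbrev QIdx (n : ℕ) := Fin n → Fin 2

/-- Operators (matrices) on the Hilbert space of `n` qubits. -/
abbrev QOp (n : ℕ) := Matrix (QIdx n) (QIdx n) ℂ

/-- The operator (`ℓ²→ℓ²`) norm of a (possibly rectangular) matrix. -/
noncomputable def opNorm {I J : Type*} [Fintype I] [Fintype J] [DecidableEq J]
    (M : Matrix I J ℂ) : ℝ :=
  ‖LinearMap.toContinuousLinearMap (Matrix.toEuclideanLin M)‖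

/-- A two-qubit operator `E` placed on qubits `i` and `j` of an `n`-qubit register
(identity elsewhere), given entrywise. -/
def twoQubitOp (n : ℕ) (i j : Fin n) (E : Fin 2 → Fin 2 → Fin 2 → Fin 2 → ℂ) : QOp n :=
  fun x y => E (x i) (x j) (y i) (y j) * (if ∀ k, k ≠ i → k ≠ j → x k = y k then 1 else 0)

/-- A single-qubit operator `E` placed on qubit `i` of an `n`-qubit register. -/
def oneQubitOp (n : ℕ) (i : Fin n) (E : Matrix (Fin 2) (Fin 2) ℂ) : QOp n :=
  fun x y => E (x i) (y i) * (if ∀ k, k ≠ i → x k = y k then 1 else 0)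

/-- Sign used to build `(|01⟩ - |10⟩)/√2`. -/
def sgnE (a b : Fin 2) : ℂ :=
  if a = 0 ∧ b = 1 then 1 else if a = 1 ∧ b = 0 then -1 else 0

/-- Entries of the two-qubit projector `P` onto `span{(|01⟩-|10⟩)/√2, |11⟩}`:
`P = (1/2)(|01⟩-|10⟩)(⟨01|-⟨10|) + |11⟩⟨11|`. -/
noncomputable def Pentry (a b c d : Fin 2) : ℂ :=
  (1 / 2) * sgnE a b * sgnE c d + (if a = 1 ∧ b = 1 ∧ c = 1 ∧ d = 1 then 1 else 0)

/-- `H_{W,0} = Σ_{i=1}^{n-1} P_{i,i+1}`. -/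
noncomputable def HW0 (n : ℕ) : QOp n :=
  ∑ i : Fin (n - 1),
    twoQubitOp n ⟨i.1, by have := i.2; omega⟩ ⟨i.1 + 1, by have := i.2; omega⟩ Pentry

/-- The all-zeros state `|0…0⟩`. -/
def ket0 (n : ℕ) : QIdx n → ℂ := fun x => if ∀ k, x k = 0 then 1 else 0

/-- The generalized W state `|W_n⟩ = n^{-1/2} Σ_i |e_i⟩`. -/
noncomputable def Wstate (n : ℕ) : QIdx n → ℂ := fun x =>
  if (Finset.univ.filter fun k => x k = 1).card = 1 then (((Real.sqrt n)⁻¹ : ℝ) : ℂ) else 0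

end QSim

namespace QSim

open scoped Classical in
/-- The spectral projector of a Hermitian matrix onto the span of its eigenvectors with
eigenvalue strictly below `Δ` (junk value `0` if the matrix is not Hermitian). -/
noncomputable def specProjBelow {I : Type*} [Fintype I] [DecidableEq I]
    (M : Matrix I I ℂ) (Δ : ℝ) : Matrix I I ℂ :=
  if hM : M.IsHermitian then
    (hM.eigenvectorUnitary : Matrix I I ℂ) *
      Matrix.diagonal (fun k => if hM.eigenvalues k < Δ then (1 : ℂ) else 0) *
      (hM.eigenvectorUnitary : Matrix I I ℂ)ᴴ
  else 0

/-- The isometry `T : ψ ↦ ψ ⊗ |anc⟩` from `ℋ` into `ℋ⊗𝒜`, as a rectangular matrix. -/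
def prodIso {I J : Type*} [DecidableEq I] (anc : J → ℂ) : Matrix (I × J) I ℂ :=
  fun p i => if p.1 = i then anc p.2 else 0

/-- `H_s` (on `ℋ⊗𝒜`) is a `(Δ,η,ε)`-simulation of `H_t` (on `ℋ`) with product encoding,
witnessed by the isometry `T̃`: `|anc⟩` is a unit vector, `T̃` is an isometry with range the
eigenspace of `H_s` of energies `< Δ`, `‖T̃ - (·⊗|anc⟩)‖ ≤ η`, and
`‖P H_s P - T̃ H_t T̃†‖ ≤ ε` where `P` is the spectral projector below `Δ`. -/
noncomputable def IsSimulationWith {I J : Type*} [Fintype I] [DecidableEq I]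
    [Fintype J] [DecidableEq J]
    (Hs : Matrix (I × J) (I × J) ℂ) (Ht : Matrix I I ℂ) (anc : J → ℂ)
    (Tt : Matrix (I × J) I ℂ) (Δ η ε : ℝ) : Prop :=
  star anc ⬝ᵥ anc = 1 ∧
  Ttᴴ * Tt = 1 ∧
  Tt * Ttᴴ = specProjBelow Hs Δ ∧
  opNorm (Tt - prodIso anc) ≤ η ∧
  opNorm (specProjBelow Hs Δ * Hs * specProjBelow Hs Δ - Tt * Ht * Ttᴴ) ≤ ε

/-- `H_s` is a `(Δ,η,ε)`-simulation of `H_t` with product encoding (ancilla state `anc`). -/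
noncomputable def IsSimulation {I J : Type*} [Fintype I] [DecidableEq I]
    [Fintype J] [DecidableEq J]
    (Hs : Matrix (I × J) (I × J) ℂ) (Ht : Matrix I I ℂ) (anc : J → ℂ) (Δ η ε : ℝ) : Prop :=
  ∃ Tt : Matrix (I × J) I ℂ, IsSimulationWith Hs Ht anc Tt Δ η ε

end QSim

namespace QSim

/-- Partial trace over the ancilla factor `𝒜`: the unique operator on `ℋ` with
`tr(tr_𝒜(ρ)·M) = tr(ρ·(M⊗I))` for all `M`. -/
noncomputable def ptraceA {I J : Type*} [Fintype J]
    (ρ : Matrix (I × J) (I × J) ℂ) : Matrix I I ℂ :=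
  fun i i' => ∑ j, ρ (i, j) (i', j)

/-- The trace norm `‖M‖₁`: the sum of the singular values of `M`. -/
noncomputable def traceNorm {I : Type*} [Fintype I] [DecidableEq I]
    (M : Matrix I I ℂ) : ℝ :=
  ∑ i, Real.sqrt ((Matrix.posSemidef_conjTranspose_mul_self M).1.eigenvalues i)

end QSim

namespace QSim

open scoped Matrix.Norms.L2Operator

theorem opNorm_eq_norm {I J : Type*} [Fintype I] [Fintype J] [DecidableEq J]
    (M : Matrix I J ℂ) : opNorm M = ‖M‖ := rfl

theorem exists_trace_mul_eq_sum {n : Type*} [Fintype n] [DecidableEq n]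
    {ρ : Matrix n n ℂ} (hρ : ρ.PosSemidef) :
    ∃ (m : ℕ) (v : Fin m → n → ℂ), ∀ M : Matrix n n ℂ,
      (ρ * M).trace = ∑ i, star (v i) ⬝ᵥ M *ᵥ v i := by
  obtain ⟨m, v, hv⟩ := Matrix.posSemidef_iff_eq_sum_vecMulVec.mp hρ
  refine ⟨m, v, fun M => ?_⟩
  rw [hv, Finset.sum_mul, trace_sum]
  refine Finset.sum_congr rfl fun i _ => ?_
  rw [vecMulVec_mul, trace_vecMulVec, dotProduct_comm, ← dotProduct_mulVec]

theorem trace_mul_nonneg {n : Type*} [Fintype n] [DecidableEq n]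
    {ρ M : Matrix n n ℂ} (hρ : ρ.PosSemidef) (hM : M.PosSemidef) : 0 ≤ (ρ * M).trace.re := by
  obtain ⟨m, v, hv⟩ := exists_trace_mul_eq_sum hρ
  rw [hv, Complex.re_sum]
  exact Finset.sum_nonneg fun i _ => hM.re_dotProduct_nonneg (v i)

theorem re_dotProduct_mulVec_le {n : Type*} [Fintype n] [DecidableEq n]
    (M : Matrix n n ℂ) (v : n → ℂ) :
    (star v ⬝ᵥ M *ᵥ v).re ≤ ‖M‖ * (star v ⬝ᵥ v).re := by
  set x : EuclideanSpace ℂ n := WithLp.toLp 2 v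
  have h1 : star v ⬝ᵥ M *ᵥ v = inner ℂ x (WithLp.toLp 2 (M *ᵥ v)) := by
    rw [EuclideanSpace.inner_eq_star_dotProduct, dotProduct_comm]
  have h2 : (star v ⬝ᵥ v).re = ‖x‖ * ‖x‖ := by
    rw [← inner_self_eq_norm_mul_norm (𝕜 := ℂ), EuclideanSpace.inner_eq_star_dotProduct,
      dotProduct_comm]
    rfl
  rw [h1, h2]
  calc (inner ℂ x (WithLp.toLp 2 (M *ᵥ v)) : ℂ).re
      ≤ ‖x‖ * ‖(WithLp.toLp 2 (M *ᵥ v) : EuclideanSpace ℂ n)‖ :=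
        re_inner_le_norm (𝕜 := ℂ) _ _
    _ ≤ ‖x‖ * (‖M‖ * ‖x‖) := by
        gcongr
        exact M.l2_opNorm_mulVec x
    _ = ‖M‖ * (‖x‖ * ‖x‖) := by ring

theorem re_trace_mul_le {n : Type*} [Fintype n] [DecidableEq n]
    {ρ : Matrix n n ℂ} (hρ : ρ.PosSemidef) (M : Matrix n n ℂ) :
    (ρ * M).trace.re ≤ ‖M‖ * ρ.trace.re := by
  obtain ⟨m, v, hv⟩ := exists_trace_mul_eq_sum hρ
  have h := hv 1
  simp only [mul_one, one_mulVec] at h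
  rw [hv, h, Complex.re_sum, Complex.re_sum, Finset.mul_sum]
  exact Finset.sum_le_sum fun i _ => re_dotProduct_mulVec_le M (v i)

theorem norm_kronecker_one_le {I J : Type*} [Fintype I] [DecidableEq I]
    [Fintype J] [DecidableEq J] (A : Matrix I I ℂ) :
    ‖A ⊗ₖ (1 : Matrix J J ℂ)‖ ≤ ‖A‖ := by
  let φ : Matrix I I ℂ →⋆ₙₐ[ℂ] Matrix (I × J) (I × J) ℂ :=
    { toFun := fun A => A ⊗ₖ (1 : Matrix J J ℂ)
      map_smul' := fun r A => smul_kronecker r A _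
      map_zero' := zero_kronecker _
      map_add' := fun A B => add_kronecker A B _
      map_mul' := fun A B => by rw [← mul_kronecker_mul, one_mul]
      map_star' := fun A => by
        simp [star_eq_conjTranspose, conjTranspose_kronecker] }
  exact NonUnitalStarAlgHom.norm_apply_le φ A

theorem trace_ptraceA_mul {I J : Type*} [Fintype I] [Fintype J] [DecidableEq J]
    (ρ : Matrix (I × J) (I × J) ℂ) (M : Matrix I I ℂ) :
    (ptraceA ρ * M).trace = (ρ * (M ⊗ₖ (1 : Matrix J J ℂ))).trace := by
  simp only [trace, diag_apply, mul_apply, ptraceA, kroneckerMap_apply, Fintype.sum_prod_type,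
    one_apply, mul_ite, mul_one, mul_zero, Finset.sum_ite_eq',
    Finset.mem_univ, if_true, Finset.sum_mul]
  exact Finset.sum_congr rfl fun i _ => Finset.sum_comm

theorem kronecker_one_mul_prodIso {I J : Type*} [Fintype I] [DecidableEq I]
    [Fintype J] [DecidableEq J] (M : Matrix I I ℂ) (anc : J → ℂ) :
    (M ⊗ₖ (1 : Matrix J J ℂ)) * (prodIso anc : Matrix (I × J) I ℂ) =
      (prodIso anc : Matrix (I × J) I ℂ) * M := by
  ext ⟨i, j⟩ k
  simp [Matrix.mul_apply, prodIso, kroneckerMap_apply, Fintype.sum_prod_type, one_apply, mul_comm]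

theorem posSemidef_sub_specProjBelow {n : Type*} [Fintype n] [DecidableEq n]
    {H : Matrix n n ℂ} (hH : H.IsHermitian) (Δ : ℝ) :
    (H - specProjBelow H Δ * H * specProjBelow H Δ
      - (Δ : ℂ) • (1 - specProjBelow H Δ)).PosSemidef := by
  classical
  set U : Matrix n n ℂ := (hH.eigenvectorUnitary : Matrix n n ℂ)
  have hUU : Uᴴ * U = 1 := Unitary.coe_star_mul_self hH.eigenvectorUnitary
  have hUU' : U * Uᴴ = 1 := Unitary.coe_mul_star_self hH.eigenvectorUnitary
  set D : n → ℂ := fun k => if hH.eigenvalues k < Δ then 1 else 0 with hD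
  have hP : specProjBelow H Δ = U * diagonal D * Uᴴ := by
    rw [specProjBelow, dif_pos hH]
  set L : n → ℂ := fun k => (hH.eigenvalues k : ℂ) with hL
  have hHU : H = U * diagonal L * Uᴴ := by
    conv_lhs => rw [hH.spectral_theorem, Unitary.conjStarAlgAut_apply]
    rfl
  have key : H - specProjBelow H Δ * H * specProjBelow H Δ
      - (Δ : ℂ) • (1 - specProjBelow H Δ)
      = U * diagonal (fun k => L k - D k * L k * D k - (Δ : ℂ) * (1 - D k)) * Uᴴ := by
    have hc : ∀ X Y : Matrix n n ℂ, U * X * Uᴴ * (U * Y * Uᴴ) = U * (X * Y) * Uᴴ := by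
      intro X Y
      calc U * X * Uᴴ * (U * Y * Uᴴ) = U * X * (Uᴴ * U) * Y * Uᴴ := by simp only [mul_assoc]
        _ = U * (X * Y) * Uᴴ := by rw [hUU]; simp only [mul_one, mul_assoc]
    have hdiag : diagonal (fun k => L k - D k * L k * D k - (Δ : ℂ) * (1 - D k))
        = diagonal L - diagonal D * diagonal L * diagonal D
          - (Δ : ℂ) • (1 - diagonal D) := by
      ext i j
      by_cases h : i = j
      · subst h; simp
      · simp [h]
    rw [hP, hdiag]
    conv_lhs => rw [hHU]
    rw [hc, hc, mul_sub, mul_sub, sub_mul, sub_mul, mul_smul_comm, smul_mul_assoc, mul_sub,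
      sub_mul, mul_one, hUU']
  rw [key]
  refine (PosSemidef.diagonal fun k => ?_).mul_mul_conjTranspose_same U
  by_cases h : hH.eigenvalues k < Δ
  · simp [hD, h]
  · have : (Δ : ℂ) ≤ (hH.eigenvalues k : ℂ) := by exact_mod_cast not_lt.mp h
    simpa [hD, hL, h] using this


/-- If `T` intertwines `A` and `K`, and the isometry `V` is `η`-close to `T`, then the energy of a
state with respect to `K` exceeds that of `V A V†` by at most `4η‖A‖` plus `‖A‖` times the weight
of the state outside the range of `V`. -/
theorem re_trace_mul_le_of_intertwining {m n : Type*} [Fintype m] [DecidableEq m]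
    [Fintype n] [DecidableEq n] {A : Matrix n n ℂ} {K : Matrix m m ℂ} {T V : Matrix m n ℂ}
    {η : ℝ} (hK : K.IsHermitian) (hKA : ‖K‖ ≤ ‖A‖) (hKT : K * T = T * A)
    (hV : Vᴴ * V = 1) (hVT : ‖V - T‖ ≤ η)
    {ρ : Matrix m m ℂ} (hρ : ρ.PosSemidef) (hρ_tr : ρ.trace = 1) :
    (ρ * K).trace.re ≤ (ρ * (V * A * Vᴴ)).trace.re + 4 * η * ‖A‖
      + ‖A‖ * (ρ * (1 - V * Vᴴ)).trace.re := by
  set P := V * Vᴴ with hP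
  set E := (K * (V - T) - (V - T) * A) * Vᴴ with hE
  have hη0 : 0 ≤ η := (norm_nonneg _).trans hVT
  have hPH : Pᴴ = P := by rw [hP, conjTranspose_mul, conjTranspose_conjTranspose]
  have hPV : P * V = V := by rw [hP, Matrix.mul_assoc, hV, Matrix.mul_one]
  have hPP : P * P = P := by
    conv_lhs => rw [hP, ← Matrix.mul_assoc, ← hP, hPV]
  have hQ : IsStarProjection (1 - P) :=
    IsStarProjection.one_sub ⟨hPP, hPH⟩
  have hQH : (1 - P)ᴴ = 1 - P := hQ.isSelfAdjoint
  have hQQ : (1 - P) * (1 - P) = 1 - P := hQ.isIdempotentElem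
  have hQV : (1 - P) * V = 0 := by rw [Matrix.sub_mul, hPV, Matrix.one_mul, sub_self]
  have hone : ‖(1 : Matrix n n ℂ)‖ ≤ 1 :=
    IsStarProjection.norm_le _ (.one _)
  have hVnorm : ‖Vᴴ‖ ≤ 1 := by
    rw [l2_opNorm_conjTranspose]
    have := l2_opNorm_conjTranspose_mul_self V
    rw [hV] at this
    nlinarith [norm_nonneg V]
  have hEnorm : ‖E‖ ≤ 2 * η * ‖A‖ := by
    calc ‖E‖ ≤ ‖K * (V - T) - (V - T) * A‖ * ‖Vᴴ‖ := l2_opNorm_mul _ _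
      _ ≤ ‖K * (V - T) - (V - T) * A‖ := mul_le_of_le_one_right (norm_nonneg _) hVnorm
      _ ≤ ‖K‖ * ‖V - T‖ + ‖V - T‖ * ‖A‖ :=
          (norm_sub_le _ _).trans (add_le_add (l2_opNorm_mul _ _) (l2_opNorm_mul _ _))
      _ ≤ ‖A‖ * η + η * ‖A‖ := by gcongr
      _ = 2 * η * ‖A‖ := by ring
  have hKP : K * P = V * A * Vᴴ + E := by
    rw [hE, hP, Matrix.mul_sub, Matrix.sub_mul V, hKT, ← Matrix.mul_assoc, ← Matrix.add_mul]
    congr 1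
    abel
  have hQKP : (1 - P) * K * P = (1 - P) * E := by
    rw [Matrix.mul_assoc, hKP, Matrix.mul_add, Matrix.mul_assoc V, ← Matrix.mul_assoc _ V,
      hQV, Matrix.zero_mul, zero_add]
  have hPKQ : P * K * (1 - P) = Eᴴ * (1 - P) := by
    have := congrArg conjTranspose hQKP
    rwa [conjTranspose_mul, conjTranspose_mul (1 - P), conjTranspose_mul (1 - P), hQH, hK.eq, hPH,
      ← Matrix.mul_assoc] at this
  have hEQ : ‖Eᴴ * (1 - P)‖ ≤ 2 * η * ‖A‖ :=
    (l2_opNorm_mul _ _).trans <| by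
      rw [l2_opNorm_conjTranspose]
      exact (mul_le_of_le_one_right (norm_nonneg _) (IsStarProjection.norm_le _ hQ)).trans hEnorm
  have hsplit : K = V * A * Vᴴ + E + Eᴴ * (1 - P) + (1 - P) * K * (1 - P) := by
    rw [← hPKQ, ← hKP]
    noncomm_ring
  have hρ1 : ρ.trace.re = 1 := by rw [hρ_tr, Complex.one_re]
  have hQKQ : (ρ * ((1 - P) * K * (1 - P))).trace.re ≤ ‖A‖ * (ρ * (1 - P)).trace.re := by
    have hps : ((1 - P) * ρ * (1 - P)).PosSemidef := by
      have := hρ.conjTranspose_mul_mul_same (1 - P)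
      rwa [hQH] at this
    have h1 : (ρ * ((1 - P) * K * (1 - P))).trace = ((1 - P) * ρ * (1 - P) * K).trace := by
      rw [← Matrix.mul_assoc, trace_mul_comm]
      simp only [Matrix.mul_assoc]
    have h2 : ((1 - P) * ρ * (1 - P)).trace = (ρ * (1 - P)).trace := by
      rw [trace_mul_comm, ← Matrix.mul_assoc, hQQ, trace_mul_comm]
    rw [h1, ← h2]
    exact (re_trace_mul_le hps K).trans
      (mul_le_mul_of_nonneg_right hKA (Complex.nonneg_iff.mp hps.trace_nonneg).1)
  have hE1 := re_trace_mul_le hρ E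
  have hE2 := re_trace_mul_le hρ (Eᴴ * (1 - P))
  rw [hρ1, mul_one] at hE1 hE2
  have htr : (ρ * K).trace.re = (ρ * (V * A * Vᴴ)).trace.re + (ρ * E).trace.re
      + (ρ * (Eᴴ * (1 - P))).trace.re + (ρ * ((1 - P) * K * (1 - P))).trace.re := by
    conv_lhs => rw [hsplit]
    simp only [Matrix.mul_add, trace_add, Complex.add_re]
  linarith

/-- soundness of product-encoded simulations.  If `H_s` is positive
semidefinite, `‖H_t‖ ≤ Δ`, and `(anc, T̃)` witness a product-encoded simulation with
parameters `(Δ, η, ε)` where `η ≤ 1/3`, then every density operator `ρ` on `ℋ⊗𝒜` of low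
energy `tr(ρH_s) ≤ ε' ≤ Δ/2` satisfies
`tr(tr_𝒜(ρ)·H_t) ≤ 5ε' + ε + (4√(2η+η²) + 2η)·‖H_t‖`. -/
theorem simulation_soundness {I J : Type*} [Fintype I] [DecidableEq I]
    [Fintype J] [DecidableEq J]
    (Ht : Matrix I I ℂ) (hHt : Ht.IsHermitian)
    (Hs : Matrix (I × J) (I × J) ℂ) (hHs : Hs.PosSemidef)
    (Δ η ε : ℝ) (hΔ : 0 < Δ) (hHtΔ : opNorm Ht ≤ Δ)
    (anc : J → ℂ) (hanc : star anc ⬝ᵥ anc = 1)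
    (Tt : Matrix (I × J) I ℂ)
    (hT_iso : Ttᴴ * Tt = 1)
    (hT_proj : Tt * Ttᴴ = specProjBelow Hs Δ)
    (hT_close : opNorm (Tt - prodIso anc) ≤ η) (hη : η ≤ 1 / 3)
    (hT_spec : opNorm (specProjBelow Hs Δ * Hs * specProjBelow Hs Δ - Tt * Ht * Ttᴴ) ≤ ε)
    (ρ : Matrix (I × J) (I × J) ℂ) (hρ : ρ.PosSemidef) (hρ_tr : ρ.trace = 1)
    (ε' : ℝ) (hε'0 : 0 ≤ ε') (hε'Δ : ε' ≤ Δ / 2) (hρ_low : (ρ * Hs).trace.re ≤ ε') :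
    ((ptraceA ρ) * Ht).trace.re
      ≤ 5 * ε' + ε + (4 * Real.sqrt (2 * η + η ^ 2) + 2 * η) * opNorm Ht := by
  set P := specProjBelow Hs Δ with hPdef
  have hKH : (Ht ⊗ₖ (1 : Matrix J J ℂ)).IsHermitian := by
    rw [IsHermitian, conjTranspose_kronecker, hHt.eq, conjTranspose_one]
  have hK := re_trace_mul_le_of_intertwining hKH (norm_kronecker_one_le Ht)
    (kronecker_one_mul_prodIso Ht anc) hT_iso hT_close hρ hρ_tr
  rw [← trace_ptraceA_mul, hT_proj] at hK
  simp only [opNorm_eq_norm] at *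
  have hη0 : 0 ≤ η := (norm_nonneg _).trans hT_close
  have hPH : Pᴴ = P := by rw [← hT_proj, conjTranspose_mul, conjTranspose_conjTranspose]
  have hPP : P * P = P := by
    rw [← hT_proj, Matrix.mul_assoc, ← Matrix.mul_assoc _ Tt, hT_iso, Matrix.one_mul]
  have ha : 0 ≤ (ρ * (1 - P)).trace.re := by
    have hQ : IsStarProjection (1 - P) := IsStarProjection.one_sub ⟨hPP, hPH⟩
    have hQH : (1 - P)ᴴ = 1 - P := hQ.isSelfAdjoint
    have := posSemidef_conjTranspose_mul_self (1 - P)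
    rw [hQH, hQ.isIdempotentElem.eq] at this
    exact trace_mul_nonneg hρ this
  have hlow : (ρ * (P * Hs * P)).trace.re + Δ * (ρ * (1 - P)).trace.re ≤ ε' := by
    have := trace_mul_nonneg hρ (posSemidef_sub_specProjBelow hHs.isHermitian Δ)
    rw [← hPdef, Matrix.mul_sub, Matrix.mul_sub, trace_sub, trace_sub, Matrix.mul_smul,
      trace_smul, Complex.sub_re, Complex.sub_re, smul_eq_mul, Complex.re_ofReal_mul] at this
    linarith
  have hspec := re_trace_mul_le hρ (-(P * Hs * P - Tt * Ht * Ttᴴ))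
  rw [norm_neg, hρ_tr, Complex.one_re, mul_one, neg_sub, Matrix.mul_sub, trace_sub,
    Complex.sub_re] at hspec
  have hsqrt : η ≤ √(2 * η + η ^ 2) := Real.le_sqrt_of_sq_le (by linarith)
  have hsqrt' : η * ‖Ht‖ ≤ √(2 * η + η ^ 2) * ‖Ht‖ :=
    mul_le_mul_of_nonneg_right hsqrt (norm_nonneg _)
  have hηh : 0 ≤ η * ‖Ht‖ := mul_nonneg hη0 (norm_nonneg _)
  have hha := mul_le_mul_of_nonneg_right hHtΔ ha
  linarith

end QSim
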